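/- Let G be the complete graph on a finite vertex set with at least 3 vertices, with a nonnegative weight w(e) on each edge, let M1 be a perfect matching of G, and let P be an acyclic 2-matching of G such that no edge of M1 is an edge of P. Then there exists a matching M2 contained in the edge set of P such that the graph with edge set M1 ∪ M2 is an acyclic 2-matching of G and the total weight of M2 is at least one third of the total weight of the edges of P. -/

import Mathlib

/-- A set of edges is a matching: each edge is non-diagonal (joins two distinct
vertices) and no two distinct edges share a vertex. -/
def IsMatchingSet {V : Type*} (M : Finset (Sym2 V)) : Prop :=
  (∀ e ∈ M, ¬ e.IsDiag) ∧
    ∀ e ∈ M, ∀ f ∈ M, e ≠ f → ∀ v : V, v ∈ e → v ∉ f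

/-- A set of edges is a perfect matching: a matching covering every vertex. -/
def IsPerfectMatchingSet {V : Type*} (M : Finset (Sym2 V)) : Prop :=
  IsMatchingSet M ∧ ∀ v : V, ∃ e ∈ M, v ∈ e

/-- A set of edges is a 2-matching: each edge is non-diagonal and every vertex
is incident to at most two of the edges. -/
def IsTwoMatchingSet {V : Type*} [DecidableEq V] (C : Finset (Sym2 V)) : Prop :=
  (∀ e ∈ C, ¬ e.IsDiag) ∧
    ∀ v : V, (C.filter (fun e => v ∈ e)).card ≤ 2

/-- A set of edges is an acyclic 2-matching: a 2-matching whose associated graph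
contains no cycle, i.e. it is a vertex-disjoint union of paths. -/
def IsAcyclicTwoMatchingSet {V : Type*} [DecidableEq V] (C : Finset (Sym2 V)) : Prop :=
  IsTwoMatchingSet C ∧ (SimpleGraph.fromEdgeSet (↑C : Set (Sym2 V))).IsAcyclic

/-- A vertex set closed under adjacency separates its elements from its complement. -/
lemma SimpleGraph.not_reachable_of_closed {V : Type*} {G : SimpleGraph V} (S : Set V)
    (hS : ∀ a ∈ S, ∀ b, G.Adj a b → b ∈ S) {u x : V} (hu : u ∈ S) (hx : x ∉ S) :
    ¬ G.Reachable u x := by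
  rintro ⟨p⟩
  induction p with
  | nil => exact hx hu
  | cons h p ih => exact ih (hS _ hu _ h) hx

/-- In a graph of maximum degree two, a component has at most two vertices of degree at most
one. -/
lemma SimpleGraph.not_reachable_of_three_ends {V : Type*} {G : SimpleGraph V}
    (h2 : ∀ v a b c, G.Adj v a → G.Adj v b → G.Adj v c → a = b ∨ a = c ∨ b = c)
    {x z t : V} (hx : ∀ a b, G.Adj x a → G.Adj x b → a = b)
    (hz : ∀ a b, G.Adj z a → G.Adj z b → a = b)
    (ht : ∀ a b, G.Adj t a → G.Adj t b → a = b)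
    (hxt : x ≠ t) (hzt : z ≠ t) (hxz : x ≠ z) (h : G.Reachable x z) : ¬ G.Reachable x t := by
  classical
  obtain ⟨p, hp⟩ := h.exists_isPath
  have hinj : ∀ i j, i ≤ p.length → j ≤ p.length → p.getVert i = p.getVert j → i = j :=
    fun i j hi hj hij => hp.getVert_injOn (by simpa using hi) (by simpa using hj) hij
  have hadj : ∀ i, i < p.length → G.Adj (p.getVert i) (p.getVert (i + 1)) :=
    fun i hi => p.adj_getVert_succ hi
  have h0 : p.getVert 0 = x := p.getVert_zero
  have hl : p.getVert p.length = z := p.getVert_length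
  have hpos : 0 < p.length := by
    rcases Nat.eq_zero_or_pos p.length with h | h
    · rw [h, h0] at hl; exact absurd hl hxz
    · exact h
  have interior : ∀ i, i + 2 ≤ p.length → ∀ b, G.Adj (p.getVert (i + 1)) b →
      b = p.getVert i ∨ b = p.getVert (i + 2) := by
    intro i hi b hb
    have e1 := (hadj i (by lia)).symm
    have e2 := hadj (i + 1) (by lia)
    rcases h2 _ _ _ _ e1 e2 hb with h | h | h
    · have := hinj _ _ (by lia) (by lia) h
      lia
    · exact Or.inl h.symm
    · exact Or.inr h.symm
  refine not_reachable_of_closed {v | ∃ i, i ≤ p.length ∧ p.getVert i = v} ?_ ⟨0, by lia, h0⟩ ?_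
  · rintro _ ⟨i, hi, rfl⟩ b hb
    rcases Nat.eq_zero_or_pos i with rfl | hi0
    · exact ⟨1, hpos, hx _ _ (by simpa using hadj 0 hpos) (by simpa using hb)⟩
    · obtain ⟨j, rfl⟩ : ∃ j, i = j + 1 := ⟨i - 1, by lia⟩
      rcases Nat.lt_or_ge (j + 1) p.length with hj | hj
      · rcases interior j hj b hb with h | h
        · exact ⟨j, by lia, h.symm⟩
        · exact ⟨j + 2, by lia, h.symm⟩
      · have hj' : j + 1 = p.length := by lia
        have e := (hadj j (by lia)).symm
        rw [hj', hl] at hb e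
        exact ⟨j, by lia, hz _ _ e hb⟩
  · rintro ⟨i, hi, rfl⟩
    have i0 : i ≠ 0 := fun h => hxt (by rw [h, h0])
    have il : i ≠ p.length := fun h => hzt (by rw [h, hl])
    obtain ⟨j, rfl⟩ : ∃ j, i = j + 1 := ⟨i - 1, by lia⟩
    have := hinj _ _ (by lia) (by lia) (ht _ _ (hadj j (by lia)).symm (hadj (j + 1) (by lia)))
    lia

/-- A finite acyclic graph with an edge has a vertex with exactly one neighbour. -/
lemma SimpleGraph.IsAcyclic.exists_leaf {V : Type*} [Finite V] {G : SimpleGraph V}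
    (hG : G.IsAcyclic) {a b : V} (hab : G.Adj a b) :
    ∃ u x, G.Adj u x ∧ ∀ y, G.Adj u y → y = x := by
  have : Nonempty V := ⟨a⟩
  obtain ⟨u, v, p, hp, hmax⟩ := SimpleGraph.Walk.exists_isPath_forall_isPath_length_le_length G
  have hnil : ¬ p.Nil := by
    have := hmax _ _ hab.toWalk (by simp [hab.ne])
    rw [← SimpleGraph.Walk.length_eq_zero_iff]
    simp at this
    lia
  refine ⟨u, p.snd, p.adj_snd hnil, fun y hy => hG.eq_snd_of_adj_start hp hy ?_⟩
  by_contra hmem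
  have := hmax _ _ (p.cons hy.symm) (hp.cons hmem)
  simp at this

lemma IsMatchingSet.eq_of_mem {V : Type*} {M : Finset (Sym2 V)} (hM : IsMatchingSet M)
    {e f : Sym2 V} (he : e ∈ M) (hf : f ∈ M) {v : V} (hve : v ∈ e) (hvf : v ∈ f) : e = f := by
  by_contra h
  exact hM.2 e he f hf h v hve hvf

lemma IsMatchingSet.card_filter_le_one {V : Type*} [DecidableEq V] {M : Finset (Sym2 V)}
    (hM : IsMatchingSet M) (v : V) : (M.filter (fun e => v ∈ e)).card ≤ 1 := by
  rw [Finset.card_le_one]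
  intro a ha b hb
  rw [Finset.mem_filter] at ha hb
  exact hM.eq_of_mem ha.1 hb.1 ha.2 hb.2

lemma IsMatchingSet.isTwoMatchingSet_union {V : Type*} [DecidableEq V] {M C : Finset (Sym2 V)}
    (hM : IsMatchingSet M) (hC : IsMatchingSet C) : IsTwoMatchingSet (M ∪ C) := by
  refine ⟨fun e he => (Finset.mem_union.1 he).elim (hM.1 e) (hC.1 e), fun v => ?_⟩
  rw [Finset.filter_union]
  have := Finset.card_union_le (M.filter (fun e => v ∈ e)) (C.filter (fun e => v ∈ e))
  have := hM.card_filter_le_one v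
  have := hC.card_filter_le_one v
  lia

lemma IsMatchingSet.isAcyclic {V : Type*} {M : Finset (Sym2 V)} (hM : IsMatchingSet M) :
    (SimpleGraph.fromEdgeSet (↑M : Set (Sym2 V))).IsAcyclic := by
  rw [SimpleGraph.isAcyclic_iff_forall_adj_isBridge]
  intro a b hab
  rw [SimpleGraph.isBridge_iff]
  refine SimpleGraph.not_reachable_of_closed {a} ?_ rfl hab.ne'
  rintro _ rfl c hc
  rw [SimpleGraph.fromEdgeSet_adj] at hab
  simp only [SimpleGraph.deleteEdges_adj, SimpleGraph.fromEdgeSet_adj, Set.mem_singleton_iff] at hc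
  exact absurd (hM.eq_of_mem hc.1.1 hab.1 (Sym2.mem_mk_left _ c) (Sym2.mem_mk_left _ b)) hc.2

/-- The graph formed by `M` and the edges of `P` of color `i`. -/
def colorGraph {V : Type*} [DecidableEq V] (M P : Finset (Sym2 V)) (f : Sym2 V → Fin 3)
    (i : Fin 3) : SimpleGraph V :=
  SimpleGraph.fromEdgeSet (↑(M ∪ P.filter (fun e => f e = i)) : Set (Sym2 V))

lemma colorGraph_adj {V : Type*} [DecidableEq V] {M P : Finset (Sym2 V)} {f : Sym2 V → Fin 3}
    {i : Fin 3} {a b : V} : (colorGraph M P f i).Adj a b ↔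
      (s(a, b) ∈ M ∨ s(a, b) ∈ P ∧ f s(a, b) = i) ∧ a ≠ b := by
  simp [colorGraph, or_and_right]

/-- A coloring of `P` whose color classes are matchings closing no cycle with `M`. -/
def IsGoodColoring {V : Type*} [DecidableEq V] (M P : Finset (Sym2 V))
    (f : Sym2 V → Fin 3) : Prop :=
  ∀ i, IsMatchingSet (P.filter (fun e => f e = i)) ∧ (colorGraph M P f i).IsAcyclic

lemma IsGoodColoring.extend {V : Type*} [DecidableEq V] {M P : Finset (Sym2 V)}
    {f : Sym2 V → Fin 3} (hf : IsGoodColoring M P f) {p q : V} (hpq : p ≠ q)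
    (hnew : s(p, q) ∉ P) {i : Fin 3} (hfree : ∀ g ∈ P, f g = i → p ∉ g ∧ q ∉ g)
    (hreach : ¬ (colorGraph M P f i).Reachable p q) :
    IsGoodColoring M (insert s(p, q) P) (Function.update f s(p, q) i) := by
  have hval : ∀ g ∈ P, Function.update f s(p, q) i g = f g := fun g hg =>
    Function.update_of_ne (by rintro rfl; exact hnew hg) _ _
  intro j
  by_cases hj : j = i
  · subst hj
    have hfilter : (insert s(p, q) P).filter (fun e => Function.update f s(p, q) j e = j)
        = insert s(p, q) (P.filter (fun e => f e = j)) := by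
      ext g
      simp only [Finset.mem_filter, Finset.mem_insert]
      grind
    constructor
    · rw [hfilter]
      refine ⟨fun e he => ?_, fun e he g hg hne v hve hvg => ?_⟩
      · rcases Finset.mem_insert.1 he with rfl | he
        · simpa using hpq
        · exact (hf j).1.1 e he
      · have key : ∀ g ∈ P.filter (fun e => f e = j), ∀ v ∈ s(p, q), v ∉ g := by
          intro g hg v hv
          rw [Finset.mem_filter] at hg
          have := hfree g hg.1 hg.2
          rcases Sym2.mem_iff.1 hv with rfl | rfl
          · exact this.1
          · exact this.2
        rcases Finset.mem_insert.1 he with rfl | he <;> rcases Finset.mem_insert.1 hg with rfl | hg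
        · exact hne rfl
        · exact key g hg v hve hvg
        · exact key e he v hvg hve
        · exact (hf j).1.2 e he g hg hne v hve hvg
    · have : colorGraph M (insert s(p, q) P) (Function.update f s(p, q) j) j
          = colorGraph M P f j ⊔ SimpleGraph.edge p q := by
        rw [colorGraph, colorGraph, hfilter, SimpleGraph.edge, ← SimpleGraph.fromEdgeSet_union]
        congr 1
        ext g
        simp
      rw [this]
      exact SimpleGraph.IsAcyclic.sup_edge_of_not_reachable hreach (hf j).2
  · have hfilter : (insert s(p, q) P).filter (fun e => Function.update f s(p, q) i e = j)
        = P.filter (fun e => f e = j) := by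
      ext g
      simp only [Finset.mem_filter, Finset.mem_insert]
      grind
    rw [colorGraph, hfilter]
    exact hf j

lemma IsMatchingSet.eq_right {V : Type*} {M : Finset (Sym2 V)} (hM : IsMatchingSet M)
    {v a b : V} (ha : s(v, a) ∈ M) (hb : s(v, b) ∈ M) : a = b :=
  Sym2.congr_right.1 (hM.eq_of_mem ha hb (Sym2.mem_mk_left v a) (Sym2.mem_mk_left v b))

lemma not_reachable_colorGraph_of_mate {V : Type*} [DecidableEq V] {M R : Finset (Sym2 V)}
    {h : Sym2 V → Fin 3} {i : Fin 3} (hM : IsMatchingSet M) {u u' : V} (huu' : s(u, u') ∈ M)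
    (hR : ∀ g ∈ R, h g = i → u ∉ g ∧ u' ∉ g) {v y : V} (hv : v = u ∨ v = u')
    (hyu : y ≠ u) (hyu' : y ≠ u') : ¬ (colorGraph M R h i).Reachable v y := by
  refine SimpleGraph.not_reachable_of_closed {v | v = u ∨ v = u'} ?_ hv (by simp [hyu, hyu'])
  intro a ha b hab
  rw [colorGraph_adj] at hab
  rcases hab.1 with hab | ⟨hab, hi⟩
  · rcases ha with rfl | rfl
    · exact Or.inr (hM.eq_right hab huu')
    · exact Or.inl (hM.eq_right hab (Sym2.eq_swap ▸ huu'))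
  · have := hR _ hab hi
    rcases ha with rfl | rfl <;> simp at this

lemma IsGoodColoring.extend_mate {V : Type*} [DecidableEq V] {M R : Finset (Sym2 V)}
    {h : Sym2 V → Fin 3} (hh : IsGoodColoring M R h) {i : Fin 3} (hM : IsMatchingSet M)
    {u u' : V} (huu' : s(u, u') ∈ M) (hR : ∀ g ∈ R, h g = i → u ∉ g ∧ u' ∉ g) {v y : V}
    (hv : v = u ∨ v = u') (hyu : y ≠ u) (hyu' : y ≠ u') (hnew : s(v, y) ∉ R)
    (hy : ∀ g ∈ R, h g = i → y ∉ g) :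
    IsGoodColoring M (insert s(v, y) R) (Function.update h s(v, y) i) := by
  refine hh.extend (by grind) hnew (fun g hg hi => ⟨?_, hy g hg hi⟩)
    (not_reachable_colorGraph_of_mate hM huu' hR hv hyu hyu')
  rcases hv with rfl | rfl
  · exact (hR g hg hi).1
  · exact (hR g hg hi).2

lemma SimpleGraph.not_reachable_sup_edge_of_pair {V : Type*} {G : SimpleGraph V} {u u' x t : V}
    (hu : ∀ b, G.Adj u b → b = u') (hu' : ∀ b, G.Adj u' b → b = u)
    (hxu : x ≠ u) (hxu' : x ≠ u') (htu : t ≠ u) (htx : ¬ G.Reachable t x) :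
    ¬ (G ⊔ SimpleGraph.edge u' t).Reachable u x := by
  refine not_reachable_of_closed {v | v = u ∨ v = u' ∨ G.Reachable t v} ?_ (Or.inl rfl)
    (by simp [hxu, hxu', htx])
  rintro a ha b hab
  rw [sup_adj, edge_adj] at hab
  rcases hab with hab | ⟨⟨rfl, rfl⟩ | ⟨rfl, rfl⟩, -⟩
  · rcases ha with rfl | rfl | ha
    · exact Or.inr (Or.inl (hu b hab))
    · exact Or.inl (hu' b hab)
    · exact Or.inr (Or.inr (ha.trans hab.reachable))
  · exact Or.inr (Or.inr (Reachable.refl _))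
  · exact Or.inr (Or.inl rfl)

lemma IsGoodColoring.extend_three {V : Type*} [DecidableEq V] {M Q : Finset (Sym2 V)}
    {f : Sym2 V → Fin 3} (hf : IsGoodColoring M Q f) (hM : IsMatchingSet M)
    {u u' x z t : V} (huu' : s(u, u') ∈ M) (hne : u ≠ u')
    (hQ : ∀ g ∈ Q, u ∉ g ∧ u' ∉ g)
    (hxu : x ≠ u) (hxu' : x ≠ u') (hzu : z ≠ u) (hzu' : z ≠ u') (htu : t ≠ u) (htu' : t ≠ u')
    (hzt : z ≠ t) {i j k : Fin 3} (hjk : j ≠ k)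
    (hx : ∀ g ∈ Q, f g = i → x ∉ g) (hz : ∀ g ∈ Q, f g = j → z ∉ g)
    (ht : ∀ g ∈ Q, f g = k → t ∉ g) (hij : i ≠ j)
    (hik : i = k → x ≠ t ∧ ¬ (colorGraph M Q f i).Reachable t x) :
    ∃ h, IsGoodColoring M (insert s(u, x) (insert s(u', t) (insert s(u', z) Q))) h := by
  have hzQ : s(u', z) ∉ Q := fun h => (hQ _ h).2 (Sym2.mem_mk_left _ _)
  have htQ : s(u', t) ∉ Q := fun h => (hQ _ h).2 (Sym2.mem_mk_left _ _)
  have hxQ : s(u, x) ∉ Q := fun h => (hQ _ h).1 (Sym2.mem_mk_left _ _)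
  have hct : s(u', t) ≠ s(u', z) := fun h => hzt (Sym2.congr_right.1 h).symm
  have hac : s(u, x) ≠ s(u', z) := by
    intro h; rw [Sym2.eq_iff] at h; grind
  have had : s(u, x) ≠ s(u', t) := by
    intro h; rw [Sym2.eq_iff] at h; grind
  have h1 := hf.extend_mate (i := j) hM huu' (fun g hg _ => hQ g hg) (Or.inr rfl) hzu hzu' hzQ hz
  set f1 := Function.update f s(u', z) j with hf1
  have f1c : f1 s(u', z) = j := Function.update_self ..
  have f1Q : ∀ g ∈ Q, f1 g = f g := fun g hg =>
    Function.update_of_ne (by rintro rfl; exact hzQ hg) _ _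
  have h2 := h1.extend_mate (i := k) hM huu' (v := u') (y := t) (by grind) (Or.inr rfl) htu htu'
    (by simp [hct, htQ]) (by grind)
  set f2 := Function.update f1 s(u', t) k with hf2
  have f2d : f2 s(u', t) = k := Function.update_self ..
  have f2c : f2 s(u', z) = j := by rw [hf2, Function.update_of_ne hct.symm, f1c]
  have f2Q : ∀ g ∈ Q, f2 g = f g := fun g hg => by
    rw [hf2, Function.update_of_ne (by rintro rfl; exact htQ hg), f1Q g hg]
  have hnew : s(u, x) ∉ insert s(u', t) (insert s(u', z) Q) := by simp [hac, had, hxQ]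
  refine ⟨_, h2.extend (p := u) (q := x) (i := i) hxu.symm hnew ?_ ?_⟩
  · intro g hg hgi
    rcases Finset.mem_insert.1 hg with rfl | hg
    · have := hik (by rw [← hgi, f2d])
      simp [hne, htu.symm, hxu', this.1]
    · rcases Finset.mem_insert.1 hg with rfl | hg
      · exact absurd (hgi.symm.trans f2c) hij
      · exact ⟨(hQ g hg).1, hx g hg (by rw [← f2Q g hg, hgi])⟩
  · have hmate : ∀ y, y ≠ u → y ≠ u' → ∀ v, v = u ∨ v = u' →
        ¬ (colorGraph M Q f i).Reachable v y := fun y hy hy' v hv =>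
      not_reachable_colorGraph_of_mate hM huu' (fun g hg _ => hQ g hg) hv hy hy'
    by_cases hik' : i = k
    · have hle : colorGraph M (insert s(u', t) (insert s(u', z) Q)) f2 i
          ≤ colorGraph M Q f i ⊔ SimpleGraph.edge u' t := by
        intro a b hab
        rw [colorGraph_adj] at hab
        rw [SimpleGraph.sup_adj, colorGraph_adj, SimpleGraph.edge_adj]
        obtain ⟨hab, hne⟩ := hab
        rcases hab with hab | ⟨hab, hi⟩
        · exact Or.inl ⟨Or.inl hab, hne⟩
        · rcases Finset.mem_insert.1 hab with h | h
          · rw [Sym2.eq_iff] at h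
            exact Or.inr ⟨h, hne⟩
          · rcases Finset.mem_insert.1 h with h | h
            · rw [h, f2c] at hi
              exact absurd hi.symm hij
            · exact Or.inl ⟨Or.inr ⟨h, by rw [← f2Q _ h, hi]⟩, hne⟩
      refine fun hr => SimpleGraph.not_reachable_sup_edge_of_pair ?_ ?_ hxu hxu' htu
        (hik hik').2 (hr.mono hle)
      · intro b hb
        by_contra hbu
        exact hmate b hb.ne' hbu u (Or.inl rfl) hb.reachable
      · intro b hb
        by_contra hbu
        exact hmate b hbu hb.ne' u' (Or.inr rfl) hb.reachable
    · exact not_reachable_colorGraph_of_mate hM huu' (by grind) (Or.inl rfl) hxu hxu'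

lemma exists_forall_color_eq {V : Type*} [DecidableEq V] {P Q : Finset (Sym2 V)}
    (hP : IsTwoMatchingSet P) (f : Sym2 V → Fin 3) (hQP : Q ⊆ P) {e : Sym2 V} (he : e ∈ P)
    (heQ : e ∉ Q) {x : V} (hx : x ∈ e) : ∃ k, ∀ g ∈ Q, x ∈ g → f g = k := by
  by_cases hex : ∃ g ∈ Q, x ∈ g
  · obtain ⟨g, hg, hxg⟩ := hex
    refine ⟨f g, fun g' hg' hxg' => ?_⟩
    by_contra hne
    have hsub : ({e, g, g'} : Finset (Sym2 V)) ⊆ P.filter (fun e => x ∈ e) := by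
      grind
    have hcard : ({e, g, g'} : Finset (Sym2 V)).card = 3 :=
      Finset.card_eq_three.2 ⟨e, g, g', by grind, by grind, by grind, rfl⟩
    have := Finset.card_le_card hsub
    have := hP.2 x
    lia
  · exact ⟨0, fun g hg hxg => absurd ⟨g, hg, hxg⟩ hex⟩

lemma notMem_of_two_edges {V : Type*} [DecidableEq V] {P Q : Finset (Sym2 V)}
    (hP : IsTwoMatchingSet P) (hQP : Q ⊆ P) {e e' : Sym2 V} (he : e ∈ P) (he' : e' ∈ P)
    (hne : e ≠ e') (heQ : e ∉ Q) (heQ' : e' ∉ Q) {x : V} (hx : x ∈ e) (hx' : x ∈ e') :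
    ∀ g ∈ Q, x ∉ g := by
  intro g hg hxg
  have hsub : ({e, e', g} : Finset (Sym2 V)) ⊆ P.filter (fun e => x ∈ e) := by
    grind
  have hcard : ({e, e', g} : Finset (Sym2 V)).card = 3 :=
    Finset.card_eq_three.2 ⟨e, e', g, by grind, by grind, by grind, rfl⟩
  have := Finset.card_le_card hsub
  have := hP.2 x
  lia

lemma IsGoodColoring.not_reachable_of_three_free {V : Type*} [DecidableEq V]
    {M Q : Finset (Sym2 V)} {f : Sym2 V → Fin 3} (hf : IsGoodColoring M Q f)
    (hM : IsMatchingSet M) {i : Fin 3} {x z t : V} (hxt : x ≠ t) (hzt : z ≠ t) (hxz : x ≠ z)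
    (hx : ∀ g ∈ Q, f g = i → x ∉ g) (hz : ∀ g ∈ Q, f g = i → z ∉ g)
    (ht : ∀ g ∈ Q, f g = i → t ∉ g) (h : (colorGraph M Q f i).Reachable x z) :
    ¬ (colorGraph M Q f i).Reachable x t := by
  have hend : ∀ y, (∀ g ∈ Q, f g = i → y ∉ g) → ∀ a b, (colorGraph M Q f i).Adj y a →
      (colorGraph M Q f i).Adj y b → a = b := by
    intro y hy a b ha hb
    rw [colorGraph_adj] at ha hb
    rcases ha.1 with ha | ha
    · rcases hb.1 with hb | hb
      · exact hM.eq_right ha hb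
      · exact absurd (Sym2.mem_mk_left _ _) (hy _ hb.1 hb.2)
    · exact absurd (Sym2.mem_mk_left _ _) (hy _ ha.1 ha.2)
  refine SimpleGraph.not_reachable_of_three_ends ?_ (hend x hx) (hend z hz) (hend t ht)
    hxt hzt hxz h
  intro v a b c ha hb hc
  rw [colorGraph_adj] at ha hb hc
  have hM' := fun a b => hM.eq_right (v := v) (a := a) (b := b)
  have hC' := fun a b => (hf i).1.eq_right (v := v) (a := a) (b := b)
  simp only [Finset.mem_filter] at hC'
  grind

/-- The three new edges at a matching edge, two of them sharing an endpoint, can be colored. -/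
lemma IsGoodColoring.exists_extend_three {V : Type*} [DecidableEq V] {M P Q : Finset (Sym2 V)}
    {f : Sym2 V → Fin 3} (hf : IsGoodColoring M Q f) (hM : IsMatchingSet M)
    (hP : IsTwoMatchingSet P) (hQP : Q ⊆ P)
    {u u' x z t : V} (huu' : s(u, u') ∈ M) (hne : u ≠ u')
    (hQ : ∀ g ∈ Q, u ∉ g ∧ u' ∉ g)
    (hxu : x ≠ u) (hxu' : x ≠ u') (hzu : z ≠ u) (hzu' : z ≠ u') (htu : t ≠ u) (htu' : t ≠ u')
    (hzt : z ≠ t) (ha : s(u, x) ∈ P) (hc : s(u', z) ∈ P) (hd : s(u', t) ∈ P) :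
    ∃ h, IsGoodColoring M (insert s(u, x) (insert s(u', t) (insert s(u', z) Q))) h := by
  have haQ : s(u, x) ∉ Q := fun h => (hQ _ h).1 (Sym2.mem_mk_left _ _)
  have hnQ : ∀ y, s(u', y) ∉ Q := fun y h => (hQ _ h).2 (Sym2.mem_mk_left _ _)
  obtain ⟨kx, hkx⟩ := exists_forall_color_eq hP f hQP ha haQ (Sym2.mem_mk_right u x)
  obtain ⟨kz, hkz⟩ := exists_forall_color_eq hP f hQP hc (hnQ z) (Sym2.mem_mk_right u' z)
  obtain ⟨kt, hkt⟩ := exists_forall_color_eq hP f hQP hd (hnQ t) (Sym2.mem_mk_right u' t)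
  have hdistinct : ∀ kx kz kt : Fin 3, (∀ g ∈ Q, x ∈ g → f g = kx) →
      (∀ g ∈ Q, z ∈ g → f g = kz) → (∀ g ∈ Q, t ∈ g → f g = kt) → ¬ (kx = kz ∧ kz = kt) →
      ∃ h, IsGoodColoring M (insert s(u, x) (insert s(u', t) (insert s(u', z) Q))) h := by
    intro kx kz kt hkx hkz hkt hk
    obtain ⟨i, j, k, hi, hj, hk, hij, hik, hjk⟩ : ∃ i j k : Fin 3, i ≠ kx ∧ j ≠ kz ∧ k ≠ kt ∧
        i ≠ j ∧ i ≠ k ∧ j ≠ k := by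
      clear hkx hkz hkt
      revert kx kz kt
      decide
    exact hf.extend_three hM huu' hne hQ hxu hxu' hzu hzu' htu htu' hzt hjk (by grind) (by grind)
      (by grind) hij (fun h => absurd h hik)
  by_cases hk : kx = kz ∧ kz = kt
  · have hac : ∀ y, s(u, x) ≠ s(u', y) := by
      intro y h; rw [Sym2.eq_iff] at h; grind
    have hshared : ∀ y, s(u', y) ∈ P → x = y → ∀ g ∈ Q, x ∉ g := fun y hy hxy =>
      notMem_of_two_edges hP hQP ha hy (hac y) haQ (hnQ y) (Sym2.mem_mk_right u x)
        (by simp [hxy])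
    have hfree : (∀ g ∈ Q, x ∉ g) →
        ∃ h, IsGoodColoring M (insert s(u, x) (insert s(u', t) (insert s(u', z) Q))) h := by
      intro h
      refine hdistinct (kz + 1) kz kt (fun g hg hxg => absurd hxg (h g hg)) hkz hkt ?_
      rintro ⟨h, -⟩
      revert h
      clear hkz hk
      revert kz
      decide
    by_cases hxz : x = z
    · exact hfree (hshared z hc hxz)
    by_cases hxt : x = t
    · exact hfree (hshared t hd hxt)
    obtain ⟨rfl, rfl⟩ := hk
    obtain ⟨i, j, hi, hj, hij⟩ : ∃ i j : Fin 3, i ≠ kx ∧ j ≠ kx ∧ i ≠ j := by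
      clear hkx hkz hkt
      revert kx
      decide
    by_cases hr : (colorGraph M Q f i).Reachable x z
    · have := hf.not_reachable_of_three_free hM hxt hzt hxz (by grind) (by grind) (by grind) hr
      exact hf.extend_three hM huu' hne hQ hxu hxu' hzu hzu' htu htu' hzt hij.symm
        (by grind) (by grind) (by grind) hij (fun _ => ⟨hxt, fun h => this h.symm⟩)
    · rw [Finset.insert_comm s(u', t)]
      exact hf.extend_three hM huu' hne hQ hxu hxu' htu htu' hzu hzu' (Ne.symm hzt) hij.symm
        (by grind) (by grind) (by grind) hij (fun _ => ⟨hxz, fun h => hr h.symm⟩)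
  · exact hdistinct kx kz kt hkx hkz hkt hk

/-- The edges of an acyclic 2-matching disjoint from a perfect matching can be colored with three
colors so that each color class is a matching closing no cycle with the perfect matching. -/
lemma exists_isGoodColoring {V : Type*} [Finite V] [DecidableEq V] {M : Finset (Sym2 V)}
    (hM : IsPerfectMatchingSet M) (P : Finset (Sym2 V)) (hP : IsAcyclicTwoMatchingSet P)
    (hdisj : Disjoint M P) : ∃ f, IsGoodColoring M P f := by
  induction P using Finset.strongInduction with
  | H P ih =>
  rcases P.eq_empty_or_nonempty with rfl | ⟨e, he⟩
  · refine ⟨fun _ => 0, fun i => ⟨by simp [IsMatchingSet], ?_⟩⟩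
    simpa [colorGraph] using hM.1.isAcyclic
  have hdiag := hP.1.1
  obtain ⟨u, x, hux, huniq⟩ : ∃ u x, (SimpleGraph.fromEdgeSet (↑P : Set (Sym2 V))).Adj u x ∧
      ∀ y, (SimpleGraph.fromEdgeSet (↑P : Set (Sym2 V))).Adj u y → y = x := by
    induction e using Sym2.ind with
    | _ a b => exact hP.2.exists_leaf (a := a) (b := b)
                (by simpa using ⟨he, by simpa using hdiag _ he⟩)
  simp only [SimpleGraph.fromEdgeSet_adj, Finset.mem_coe] at hux huniq
  obtain ⟨ha, hxu⟩ := hux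
  have hMP : ∀ g ∈ M, g ∉ P := fun g h h' => Finset.disjoint_left.1 hdisj h h'
  have hleaf : ∀ g ∈ P, u ∈ g → g = s(u, x) := by
    rintro g hg ⟨y, rfl⟩
    rw [huniq y ⟨hg, by simpa using hdiag _ hg⟩]
  obtain ⟨_, huu', u', rfl⟩ := hM.2 u
  have hne : u ≠ u' := by simpa using hM.1.1 _ huu'
  have hxu' : x ≠ u' := by
    rintro rfl
    exact hMP _ huu' ha
  set Q := P.filter (fun g => u ∉ g ∧ u' ∉ g) with hQdef
  have hQP : Q ⊆ P := Finset.filter_subset _ _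
  have hQ : ∀ g ∈ Q, u ∉ g ∧ u' ∉ g := fun g hg => (Finset.mem_filter.1 hg).2
  have haQ : s(u, x) ∉ Q := fun h => (hQ _ h).1 (Sym2.mem_mk_left _ _)
  obtain ⟨f, hf⟩ := ih Q ((Finset.ssubset_iff_of_subset hQP).2 ⟨_, ha, haQ⟩)
    ⟨⟨fun g hg => hdiag g (hQP hg), fun v =>
        (Finset.card_le_card (Finset.filter_subset_filter _ hQP)).trans (hP.1.2 v)⟩,
      hP.2.anti (SimpleGraph.fromEdgeSet_mono (by exact_mod_cast hQP))⟩
    (hdisj.mono_right hQP)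
  have hcard : (P.filter (fun g => u' ∈ g)).card ≤ 2 := hP.1.2 u'
  set D := P.filter (fun g => u' ∈ g) with hDdef
  have hPeq : P = insert s(u, x) (D ∪ Q) := by
    ext g
    simp only [hDdef, hQdef, Finset.mem_insert, Finset.mem_union, Finset.mem_filter]
    grind
  have hD : ∀ g ∈ D, ∃ y, g = s(u', y) ∧ s(u', y) ∈ P ∧ y ≠ u ∧ y ≠ u' := by
    intro g hg
    obtain ⟨hg, y, rfl⟩ := Finset.mem_filter.1 hg
    refine ⟨y, rfl, hg, ?_, ?_⟩
    · rintro rfl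
      exact hMP _ huu' (Sym2.eq_swap ▸ hg)
    · rintro rfl
      simpa using hdiag _ hg
  obtain ⟨kx, hkx⟩ := exists_forall_color_eq hP.1 f hQP ha haQ (Sym2.mem_mk_right u x)
  have hnQ : ∀ y, s(u', y) ∉ Q := fun y h => (hQ _ h).2 (Sym2.mem_mk_left _ _)
  rw [hPeq]
  obtain h0 | h1 | h2 : D.card = 0 ∨ D.card = 1 ∨ D.card = 2 := by lia
  · rw [Finset.card_eq_zero.1 h0, Finset.empty_union]
    have hk : kx + 1 ≠ kx := by clear hkx; revert kx; decide
    exact ⟨_, hf.extend_mate (i := kx + 1) hM.1 huu' (fun g hg _ => hQ g hg) (Or.inl rfl) hxu.symm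
      hxu' haQ (by grind)⟩
  · obtain ⟨c, hc⟩ := Finset.card_eq_one.1 h1
    obtain ⟨z, rfl, hcP, hzu, hzu'⟩ := hD c (by simp [hc])
    obtain ⟨kz, hkz⟩ := exists_forall_color_eq hP.1 f hQP hcP (hnQ z) (Sym2.mem_mk_right u' z)
    obtain ⟨i, j, hi, hj, hij⟩ : ∃ i j : Fin 3, i ≠ kx ∧ j ≠ kz ∧ i ≠ j := by
      clear hkx hkz
      revert kx kz
      decide
    have h1 := hf.extend_mate (i := j) hM.1 huu' (fun g hg _ => hQ g hg) (Or.inr rfl) hzu hzu'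
      (hnQ z) (by grind)
    have hval : ∀ g ∈ insert s(u', z) Q, Function.update f s(u', z) j g = i →
        g ∈ Q ∧ f g = i := by
      intro g hg hgi
      rcases Finset.mem_insert.1 hg with rfl | hg
      · rw [Function.update_self] at hgi
        exact absurd hgi.symm hij
      · rw [Function.update_of_ne (by rintro rfl; exact hnQ z hg)] at hgi
        exact ⟨hg, hgi⟩
    have hac : s(u, x) ≠ s(u', z) := by
      intro h; rw [Sym2.eq_iff] at h; grind
    rw [hc, ← Finset.insert_eq]
    exact ⟨_, h1.extend_mate (i := i) hM.1 huu' (fun g hg hgi => hQ g (hval g hg hgi).1)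
      (Or.inl rfl) hxu.symm hxu' (by simp [hac, haQ])
      (fun g hg hgi hxg => hi ((hval g hg hgi).2 ▸ hkx g (hval g hg hgi).1 hxg))⟩
  · obtain ⟨d, c, hdc, hdceq⟩ := Finset.card_eq_two.1 h2
    obtain ⟨z, rfl, hcP, hzu, hzu'⟩ := hD c (by simp [hdceq])
    obtain ⟨t, rfl, hdP, htu, htu'⟩ := hD d (by simp [hdceq])
    have hzt : z ≠ t := by
      rintro rfl
      exact hdc rfl
    rw [hdceq, Finset.insert_union, ← Finset.insert_eq]
    exact hf.exists_extend_three hM.1 hP.1 hQP huu' hne hQ hxu.symm hxu' hzu hzu' htu htu' hzt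
      ha hcP hdP

/-- In the complete graph on a finite vertex set with at least 3 vertices,
with nonnegative edge weights, if `M1` is a perfect matching and `P` is an acyclic
2-matching sharing no edge with `M1`, then there is a matching `M2 ⊆ P` such that
`M1 ∪ M2` is an acyclic 2-matching and the weight of `M2` is at least a third of the
weight of `P`. -/
theorem stmt5 {V : Type*} [Fintype V] [DecidableEq V]
    (hV : 3 ≤ Fintype.card V)
    (w : Sym2 V → ℝ) (hw : ∀ e, 0 ≤ w e)
    (M1 : Finset (Sym2 V)) (hM1 : IsPerfectMatchingSet M1)
    (P : Finset (Sym2 V)) (hP : IsAcyclicTwoMatchingSet P)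
    (hdisj : Disjoint M1 P) :
    ∃ M2 ⊆ P, IsMatchingSet M2 ∧ IsAcyclicTwoMatchingSet (M1 ∪ M2) ∧
      (1 / 3 : ℝ) * ∑ e ∈ P, w e ≤ ∑ e ∈ M2, w e := by
  obtain ⟨f, hf⟩ := exists_isGoodColoring hM1 P hP hdisj
  have hsum : ∑ i, ∑ e ∈ P with f e = i, w e = ∑ e ∈ P, w e := Finset.sum_fiberwise P f w
  obtain ⟨i, -, hi⟩ : ∃ i ∈ Finset.univ,
      (1 / 3 : ℝ) * ∑ e ∈ P, w e ≤ ∑ e ∈ P with f e = i, w e := by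
    refine Finset.exists_le_of_sum_le Finset.univ_nonempty ?_
    rw [hsum, Finset.sum_const, Finset.card_univ, Fintype.card_fin, nsmul_eq_mul]
    apply le_of_eq
    push_cast
    ring
  exact ⟨_, Finset.filter_subset _ _, (hf i).1,
    ⟨hM1.1.isTwoMatchingSet_union (hf i).1, (hf i).2⟩, hi⟩
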